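/- arXiv:2209.02257 — 2 statements merged into one kernel-verified Lean document; each statement's English description precedes it below -/
import Mathlib

section
/- Let E be a real Hilbert space, let f_1, …, f_M : E → ℝ be differentiable and μ-strongly convex (μ > 0) with average f = (1/M)·Σ_{m=1}^M f_m, let x_* be a minimizer of f, and set σ_*² = (1/M)·Σ_{m=1}^M ‖∇f_m(x_*)‖². Fix η > 0, b ≥ 0, a point x ∈ E, and for each m ∈ {1,…,M} a point x'_m ∈ E with ‖x'_m − prox_{ηf_m}(x)‖² ≤ b. Then (1/M)·Σ_{m=1}^M ‖x'_m − x_*‖² ≤ (1/(1 + η·μ))·[ ‖x − x_*‖² + η²·σ_*² + ((1 + η·μ)²/(η·μ))·b ] (one-step expected progress of the inexact Stochastic Proximal Point Method with client sampled uniformly from [M]). -/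
open RealInnerProductSpace

section ProximalPoint

variable {E : Type*} [NormedAddCommGroup E] [InnerProductSpace ℝ E]

/-- Young's inequality for the squared norm of a sum. -/
lemma norm_add_sq_le_young {c : ℝ} (hc : 0 < c) (u w : E) :
    ‖u + w‖ ^ 2 ≤ (1 + c) * ‖u‖ ^ 2 + (1 + c) / c * ‖w‖ ^ 2 := by
  have h : 0 ≤ ‖c • u - w‖ ^ 2 / c := by positivity
  have e : ‖c • u - w‖ ^ 2 / c = c * ‖u‖ ^ 2 - 2 * ⟪u, w⟫ + ‖w‖ ^ 2 / c := by
    rw [norm_sub_sq_real, norm_smul, real_inner_smul_left, mul_pow, Real.norm_eq_abs, sq_abs]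
    field_simp
  have e' : (1 + c) / c * ‖w‖ ^ 2 = ‖w‖ ^ 2 + ‖w‖ ^ 2 / c := by
    field_simp
    ring
  rw [norm_add_sq_real, e']
  linarith

variable [CompleteSpace E]

/-- First-order optimality condition for the proximal point of a differentiable function. -/
lemma smul_gradient_eq_of_isProx {f : E → ℝ} {η : ℝ} {x p : E}
    (hf : DifferentiableAt ℝ f p)
    (hp : ∀ z, η * f p + (1 / 2) * ‖p - x‖ ^ 2 ≤ η * f z + (1 / 2) * ‖z - x‖ ^ 2) :
    η • gradient f p = x - p := by
  have hd := (hf.hasGradientAt.hasFDerivAt.const_mul η).add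
    ((((hasFDerivAt_id p).sub_const x).norm_sq).const_mul (1 / 2 : ℝ))
  have h0 := IsLocalMin.hasFDerivAt_eq_zero (Filter.Eventually.of_forall hp) hd
  refine ext_inner_right ℝ fun v => ?_
  have hv := DFunLike.congr_fun h0 v
  simp [inner_sub_left, real_inner_smul_left] at hv ⊢
  linarith

/-- The gradients of finitely many differentiable functions sum to zero at a minimizer
of their sum. -/
lemma sum_gradient_eq_zero_of_forall_sum_le {ι : Type*} [Fintype ι] {f : ι → E → ℝ} {a : E}
    (hf : ∀ i, DifferentiableAt ℝ (f i) a) (hmin : ∀ z, ∑ i, f i a ≤ ∑ i, f i z) :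
    ∑ i, gradient (f i) a = 0 := by
  have hd := HasFDerivAt.fun_sum (u := Finset.univ)
    fun i _ => (hf i).hasGradientAt.hasFDerivAt
  have h0 := IsLocalMin.hasFDerivAt_eq_zero (Filter.Eventually.of_forall hmin) hd
  rw [← map_sum] at h0
  exact (InnerProductSpace.toDual ℝ E).map_eq_zero_iff.mp h0

/-- The gradient of a strongly convex function is strongly monotone. -/
lemma inner_gradient_sub_ge_of_strongConvex {f : E → ℝ} {μ : ℝ}
    (hsc : ∀ x y : E, f y + ⟪gradient f y, x - y⟫ + μ / 2 * ‖x - y‖ ^ 2 ≤ f x) (x y : E) :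
    μ * ‖x - y‖ ^ 2 ≤ ⟪gradient f x - gradient f y, x - y⟫ := by
  have h₁ := hsc x y
  have h₂ := hsc y x
  rw [← neg_sub x y, norm_neg, inner_neg_right] at h₂
  rw [inner_sub_left]
  linarith

/-- Contraction of the proximal operator of a strongly convex function, comparing the
proximal point of `x` with `a`, the proximal point of `a + η • gradient f a`. -/
lemma norm_prox_sub_sq_le {f : E → ℝ} {η μ : ℝ} (hη : 0 < η) (hμ : 0 < μ) {x p : E} (a : E)
    (hf : DifferentiableAt ℝ f p)
    (hsc : ∀ x y : E, f y + ⟪gradient f y, x - y⟫ + μ / 2 * ‖x - y‖ ^ 2 ≤ f x)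
    (hp : ∀ z, η * f p + (1 / 2) * ‖p - x‖ ^ 2 ≤ η * f z + (1 / 2) * ‖z - x‖ ^ 2) :
    (1 + η * μ) ^ 2 * ‖p - a‖ ^ 2 ≤ ‖x - a - η • gradient f a‖ ^ 2 := by
  have hm := mul_le_mul_of_nonneg_left (inner_gradient_sub_ge_of_strongConvex hsc p a) hη.le
  rw [← real_inner_smul_left, smul_sub, smul_gradient_eq_of_isProx hf hp,
    show x - p - η • gradient f a = (x - a - η • gradient f a) - (p - a) by abel,
    inner_sub_left, real_inner_self_eq_norm_sq] at hm
  have hcs := real_inner_le_norm (x - a - η • gradient f a) (p - a)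
  have hημ : 0 < η * μ := mul_pos hη hμ
  have hle : (1 + η * μ) * ‖p - a‖ ≤ ‖x - a - η • gradient f a‖ := by
    rcases (norm_nonneg (p - a)).eq_or_lt with h | h
    · rw [← h, mul_zero]
      exact norm_nonneg _
    · refine le_of_mul_le_mul_right ?_ h
      linarith
  rw [← mul_pow]
  exact pow_le_pow_left₀ (by positivity) hle 2

end ProximalPoint

/-- One-step expected progress of the inexact Stochastic Proximal Point Method with a
uniformly sampled client: if each `x'_m` is a `b`-approximation of `prox_{ηf_m}(x)`, then
`(1/M)·Σ ‖x'_m − x_*‖² ≤ (1/(1+ημ))·[‖x − x_*‖² + η²σ_*² + ((1+ημ)²/(ημ))·b]`. -/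
theorem sppm_inexact_one_step
    {E : Type*} [NormedAddCommGroup E] [InnerProductSpace ℝ E] [CompleteSpace E]
    (M : ℕ) (hM : 0 < M) (f : Fin M → E → ℝ) (μ : ℝ) (hμ : 0 < μ)
    (hdiff : ∀ m x, DifferentiableAt ℝ (f m) x)
    (hsc : ∀ m, ∀ x y : E,
      f m y + ⟪gradient (f m) y, x - y⟫ + μ / 2 * ‖x - y‖ ^ 2 ≤ f m x)
    (xstar : E)
    (hmin : ∀ x : E,
      (1 / (M : ℝ)) * ∑ m : Fin M, f m xstar ≤ (1 / (M : ℝ)) * ∑ m : Fin M, f m x)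
    (η b : ℝ) (hη : 0 < η) (hb : 0 ≤ b) (x : E) (p x' : Fin M → E)
    (hp : ∀ m, ∀ z : E,
      η * f m (p m) + (1 / 2) * ‖p m - x‖ ^ 2 ≤ η * f m z + (1 / 2) * ‖z - x‖ ^ 2)
    (hx' : ∀ m, ‖x' m - p m‖ ^ 2 ≤ b) :
    (1 / (M : ℝ)) * ∑ m : Fin M, ‖x' m - xstar‖ ^ 2 ≤
      (1 / (1 + η * μ)) *
        (‖x - xstar‖ ^ 2 +
          η ^ 2 * ((1 / (M : ℝ)) * ∑ m : Fin M, ‖gradient (f m) xstar‖ ^ 2) +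
          ((1 + η * μ) ^ 2 / (η * μ)) * b) := by
  have hc : 0 < η * μ := mul_pos hη hμ
  have hM' : (0 : ℝ) < M := Nat.cast_pos.mpr hM
  have hgrad : ∑ m, gradient (f m) xstar = 0 :=
    sum_gradient_eq_zero_of_forall_sum_le (fun m => hdiff m xstar) fun z =>
      le_of_mul_le_mul_left (hmin z) (by positivity)
  have hterm : ∀ m, ‖x' m - xstar‖ ^ 2 ≤ (1 / (1 + η * μ)) *
      (‖x - xstar - η • gradient (f m) xstar‖ ^ 2 + ((1 + η * μ) ^ 2 / (η * μ)) * b) := by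
    intro m
    calc ‖x' m - xstar‖ ^ 2
        = ‖(p m - xstar) + (x' m - p m)‖ ^ 2 := by rw [add_comm, sub_add_sub_cancel]
      _ ≤ (1 + η * μ) * ‖p m - xstar‖ ^ 2 + (1 + η * μ) / (η * μ) * ‖x' m - p m‖ ^ 2 :=
        norm_add_sq_le_young hc _ _
      _ ≤ (1 + η * μ) * ‖p m - xstar‖ ^ 2 + (1 + η * μ) / (η * μ) * b := by
        gcongr
        exact hx' m
      _ = (1 / (1 + η * μ)) *
          ((1 + η * μ) ^ 2 * ‖p m - xstar‖ ^ 2 + ((1 + η * μ) ^ 2 / (η * μ)) * b) := by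
        field_simp
      _ ≤ _ := by
        gcongr
        exact norm_prox_sub_sq_le hη hμ xstar (hdiff m _) (hsc m) (hp m)
  have hsum : ∑ m, ‖x - xstar - η • gradient (f m) xstar‖ ^ 2 =
      M * ‖x - xstar‖ ^ 2 + η ^ 2 * ∑ m, ‖gradient (f m) xstar‖ ^ 2 := by
    simp_rw [norm_sub_sq_real (x - xstar), real_inner_smul_right, norm_smul, mul_pow,
      Real.norm_eq_abs, sq_abs, Finset.sum_add_distrib, Finset.sum_sub_distrib,
      ← Finset.mul_sum, ← inner_sum, hgrad]
    simp
  calc (1 / (M : ℝ)) * ∑ m, ‖x' m - xstar‖ ^ 2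
      ≤ (1 / (M : ℝ)) * ∑ m, (1 / (1 + η * μ)) *
        (‖x - xstar - η • gradient (f m) xstar‖ ^ 2 + ((1 + η * μ) ^ 2 / (η * μ)) * b) := by
        gcongr with m
        exact hterm m
    _ = _ := by
        rw [← Finset.mul_sum, Finset.sum_add_distrib, hsum, Finset.sum_const, Finset.card_univ,
          Fintype.card_fin, nsmul_eq_mul]
        field_simp
end

section
/- Let E be a real Hilbert space, let f_1, …, f_M : E → ℝ be differentiable, μ-strongly convex (μ > 0), with average f = (1/M)·Σ_{m=1}^M f_m satisfying δ-second-order similarity, and let x_* be a minimizer of f. Fix η > 0 with η·δ²/μ ≤ 1/2, a probability p ∈ (0, 1], b ≥ 0, and set α = η·μ/p and τ = min{ η·μ/(1 + 2η·μ), p/2 }. For points x, w ∈ E, set g_m = ∇f(w) − ∇f_m(w) and let x'_m ∈ E satisfy ‖x'_m − prox_{ηf_m}(x − η·g_m)‖² ≤ b for each m. Then (1 + α·p)·(1/M)·Σ_{m=1}^M ‖x'_m − x_*‖² + α·(1 − p)·‖w − x_*‖² ≤ (1 − τ)·( ‖x − x_*‖² + α·‖w − x_*‖² ) + ((1 + η·μ)³/(η·μ)²)·b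 (one-step Lyapunov contraction for SVRP, averaging over the uniformly sampled client and the Bernoulli(p) anchor update). -/
open RealInnerProductSpace

section ProximalPoint

variable {E : Type*} [NormedAddCommGroup E] [InnerProductSpace ℝ E] [CompleteSpace E]

theorem gradient_average {M : ℕ} {f : Fin M → E → ℝ}
    (hdiff : ∀ m x, DifferentiableAt ℝ (f m) x) (c : ℝ) (x : E) :
    gradient (fun z => c * ∑ i, f i z) x = c • ∑ i, gradient (f i) x := by
  have h : HasFDerivAt (fun z => c * ∑ i, f i z) (c • ∑ i, fderiv ℝ (f i) x) x :=
    (HasFDerivAt.fun_sum fun i _ => (hdiff i x).hasFDerivAt).const_mul c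
  simp [gradient, h.fderiv]

theorem gradient_eq_zero_of_forall_le {h : E → ℝ} {x : E} (hmin : ∀ z, h x ≤ h z) :
    gradient h x = 0 := by
  have : IsLocalMin h x := Filter.Eventually.of_forall hmin
  simp [gradient, this.fderiv_eq_zero]

/-- The optimality condition of a proximal point. -/
theorem smul_gradient_add_sub_eq_zero_of_prox {h : E → ℝ} {η : ℝ} {c y : E}
    (hd : DifferentiableAt ℝ h y)
    (hprox : ∀ z, η * h y + (1 / 2) * ‖y - c‖ ^ 2 ≤ η * h z + (1 / 2) * ‖z - c‖ ^ 2) :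
    η • gradient h y + (y - c) = 0 := by
  have hmin : IsLocalMin (fun z => η * h z + (1 / 2) * ‖z - c‖ ^ 2) y :=
    Filter.Eventually.of_forall hprox
  have hD := (hd.hasFDerivAt.const_mul η).add
    ((((hasFDerivAt_id (𝕜 := ℝ) y).sub_const c).norm_sq).const_mul (1 / 2))
  have h0 := hmin.hasFDerivAt_eq_zero hD
  refine ext_inner_right ℝ fun v => ?_
  have hv := DFunLike.congr_fun h0 v
  have hgrad : ⟪gradient h y, v⟫ = fderiv ℝ h y v := by
    simp [gradient]
  rw [inner_add_left, real_inner_smul_left, hgrad, inner_zero_left]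
  rw [inner_sub_left]
  simpa using hv

/-- Strong convexity makes the gradient strongly monotone. -/
theorem strongly_monotone_gradient {h : E → ℝ} {μ : ℝ}
    (hsc : ∀ x y : E, h y + ⟪gradient h y, x - y⟫ + μ / 2 * ‖x - y‖ ^ 2 ≤ h x) (x y : E) :
    μ * ‖x - y‖ ^ 2 ≤ ⟪gradient h x - gradient h y, x - y⟫ := by
  have h1 := hsc x y
  have h2 := hsc y x
  rw [norm_sub_rev y x, ← neg_sub x y, inner_neg_right] at h2
  rw [inner_sub_left]
  linarith

/-- A proximal step on a strongly convex function is a contraction with factor `1 / (1 + η μ)`. -/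
theorem prox_contraction {h : E → ℝ} {μ η : ℝ} (hμ : 0 ≤ μ) (hη : 0 ≤ η)
    (hd : Differentiable ℝ h)
    (hsc : ∀ x y : E, h y + ⟪gradient h y, x - y⟫ + μ / 2 * ‖x - y‖ ^ 2 ≤ h x)
    {c y : E}
    (hprox : ∀ z, η * h y + (1 / 2) * ‖y - c‖ ^ 2 ≤ η * h z + (1 / 2) * ‖z - c‖ ^ 2) (z : E) :
    (1 + η * μ) ^ 2 * ‖y - z‖ ^ 2 ≤ ‖c - (z + η • gradient h z)‖ ^ 2 := by
  have hopt := smul_gradient_add_sub_eq_zero_of_prox (hd y) hprox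
  have hmono := strongly_monotone_gradient hsc y z
  have hv : c - (z + η • gradient h z) = (y - z) + η • (gradient h y - gradient h z) := by
    have hc : c = η • gradient h y + y := by
      rw [← add_sub_assoc] at hopt
      exact (sub_eq_zero.mp hopt).symm
    rw [hc, smul_sub]
    abel
  rw [hv]
  set u := y - z
  set q := gradient h y - gradient h z
  have hlower : (1 + η * μ) * ‖u‖ ^ 2 ≤ ⟪u + η • q, u⟫ := by
    rw [inner_add_left, real_inner_smul_left, real_inner_self_eq_norm_sq]
    nlinarith
  have hsq : 0 ≤ ‖(u + η • q) - (1 + η * μ) • u‖ ^ 2 := sq_nonneg _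
  rw [norm_sub_sq_real, real_inner_smul_right, norm_smul, mul_pow, Real.norm_eq_abs,
    sq_abs] at hsq
  have hpos : 0 ≤ 1 + η * μ := by positivity
  nlinarith [mul_le_mul_of_nonneg_left hlower hpos]

end ProximalPoint

/-- Young's inequality for `‖x - z‖²`, with weights tuned to a factor `(1 + t)²`. -/
theorem norm_sub_sq_le_young {E : Type*} [NormedAddCommGroup E] {t : ℝ} (ht : 0 < t)
    (x y z : E) :
    ‖x - z‖ ^ 2 ≤ (1 + t) ^ 2 / (1 + 2 * t) * ‖y - z‖ ^ 2 + (1 + t) ^ 2 / t ^ 2 * ‖x - y‖ ^ 2 := by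
  have htri : ‖x - z‖ ≤ ‖x - y‖ + ‖y - z‖ := norm_sub_le_norm_sub_add_norm_sub x y z
  have hsq : ‖x - z‖ ^ 2 ≤ (‖x - y‖ + ‖y - z‖) ^ 2 := by gcongr
  refine hsq.trans ?_
  have key : (1 + t) ^ 2 / (1 + 2 * t) * ‖y - z‖ ^ 2 + (1 + t) ^ 2 / t ^ 2 * ‖x - y‖ ^ 2
      - (‖x - y‖ + ‖y - z‖) ^ 2
      = (t ^ 2 * ‖y - z‖ - (1 + 2 * t) * ‖x - y‖) ^ 2 / ((1 + 2 * t) * t ^ 2) := by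
    field_simp
    ring
  have : 0 ≤ (t ^ 2 * ‖y - z‖ - (1 + 2 * t) * ‖x - y‖) ^ 2 / ((1 + 2 * t) * t ^ 2) := by
    positivity
  linarith

/-- One-step Lyapunov contraction for SVRP (averaging over the uniformly sampled client
and the Bernoulli(p) anchor update): with `α = ημ/p`, `τ = min(ημ/(1+2ημ), p/2)`,
and `ηδ²/μ ≤ 1/2`,
`(1+αp)·(1/M)Σ‖x'_m − x_*‖² + α(1−p)‖w − x_*‖²
  ≤ (1−τ)(‖x − x_*‖² + α‖w − x_*‖²) + ((1+ημ)³/(ημ)²)·b`. -/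
theorem svrp_lyapunov_one_step
    {E : Type*} [NormedAddCommGroup E] [InnerProductSpace ℝ E] [CompleteSpace E]
    (M : ℕ) (hM : 0 < M) (f : Fin M → E → ℝ) (μ δ : ℝ) (hμ : 0 < μ)
    (hdiff : ∀ m x, DifferentiableAt ℝ (f m) x)
    (hsc : ∀ m, ∀ x y : E,
      f m y + ⟪gradient (f m) y, x - y⟫ + μ / 2 * ‖x - y‖ ^ 2 ≤ f m x)
    (hsim : ∀ x y : E,
      (1 / (M : ℝ)) * ∑ m : Fin M,
          ‖gradient (f m) x - gradient (fun z => (1 / (M : ℝ)) * ∑ i : Fin M, f i z) x -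
            (gradient (f m) y - gradient (fun z => (1 / (M : ℝ)) * ∑ i : Fin M, f i z) y)‖ ^ 2 ≤
        δ ^ 2 * ‖x - y‖ ^ 2)
    (xstar : E)
    (hmin : ∀ x : E,
      (1 / (M : ℝ)) * ∑ m : Fin M, f m xstar ≤ (1 / (M : ℝ)) * ∑ m : Fin M, f m x)
    (η p b α τ : ℝ) (hη : 0 < η) (hstep : η * δ ^ 2 / μ ≤ 1 / 2)
    (hp0 : 0 < p) (hp1 : p ≤ 1) (hb : 0 ≤ b)
    (hα : α = η * μ / p) (hτ : τ = min (η * μ / (1 + 2 * η * μ)) (p / 2))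
    (x w : E) (g : Fin M → E)
    (hg : ∀ m,
      g m = gradient (fun z => (1 / (M : ℝ)) * ∑ i : Fin M, f i z) w - gradient (f m) w)
    (prox x' : Fin M → E)
    (hprox : ∀ m, ∀ z : E,
      η * f m (prox m) + (1 / 2) * ‖prox m - (x - η • g m)‖ ^ 2 ≤
        η * f m z + (1 / 2) * ‖z - (x - η • g m)‖ ^ 2)
    (hx' : ∀ m, ‖x' m - prox m‖ ^ 2 ≤ b) :
    (1 + α * p) * ((1 / (M : ℝ)) * ∑ m : Fin M, ‖x' m - xstar‖ ^ 2) +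
        α * (1 - p) * ‖w - xstar‖ ^ 2 ≤
      (1 - τ) * (‖x - xstar‖ ^ 2 + α * ‖w - xstar‖ ^ 2) +
        ((1 + η * μ) ^ 3 / (η * μ) ^ 2) * b := by
  have hM' : (0 : ℝ) < M := by exact_mod_cast hM
  have ht : 0 < η * μ := by positivity
  set F : E → ℝ := fun z => (1 / (M : ℝ)) * ∑ i : Fin M, f i z with hF
  have hF0 : gradient F xstar = 0 := gradient_eq_zero_of_forall_le hmin
  have hsumF : ∀ z, ∑ m, gradient (f m) z = (M : ℝ) • gradient F z := fun z => by
    rw [hF, gradient_average hdiff, smul_smul, mul_one_div_cancel hM'.ne', one_smul]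
  set d : Fin M → E := fun m => g m + gradient (f m) xstar with hd
  have hdsum : ∑ m, d m = 0 := by
    simp only [hd, hg, Finset.sum_add_distrib, Finset.sum_sub_distrib, hsumF, hF0]
    simp [Nat.cast_smul_eq_nsmul]
  have hdsq : (1 / (M : ℝ)) * ∑ m, ‖d m‖ ^ 2 ≤ δ ^ 2 * ‖w - xstar‖ ^ 2 := by
    refine le_trans (le_of_eq ?_) (hsim w xstar)
    congr 1
    refine Finset.sum_congr rfl fun m _ => ?_
    rw [hF0, ← norm_neg]
    congr 2
    simp only [hd, hg]
    abel
  have hcontr : ∀ m, (1 + η * μ) ^ 2 * ‖prox m - xstar‖ ^ 2 ≤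
      ‖x - xstar‖ ^ 2 - 2 * η * ⟪x - xstar, d m⟫ + η ^ 2 * ‖d m‖ ^ 2 := fun m => by
    have h := prox_contraction hμ.le hη.le (fun z => hdiff m z) (hsc m) (hprox m) xstar
    have hv : x - η • g m - (xstar + η • gradient (f m) xstar) = (x - xstar) - η • d m := by
      simp only [hd, smul_add]
      abel
    rw [hv, norm_sub_sq_real (x - xstar), real_inner_smul_right, norm_smul, mul_pow,
      Real.norm_eq_abs, sq_abs] at h
    linarith
  have hy : ∀ m, ‖x' m - xstar‖ ^ 2 ≤ 1 / (1 + 2 * (η * μ)) *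
      (‖x - xstar‖ ^ 2 - 2 * η * ⟪x - xstar, d m⟫ + η ^ 2 * ‖d m‖ ^ 2)
        + (1 + η * μ) ^ 2 / (η * μ) ^ 2 * b := fun m => by
    refine (norm_sub_sq_le_young ht (x' m) (prox m) xstar).trans ?_
    refine add_le_add ?_ (by gcongr; exact hx' m)
    calc _ = 1 / (1 + 2 * (η * μ)) * ((1 + η * μ) ^ 2 * ‖prox m - xstar‖ ^ 2) := by ring
      _ ≤ _ := by gcongr; exact hcontr m
  have havg : (1 / (M : ℝ)) * ∑ m, ‖x' m - xstar‖ ^ 2 ≤ 1 / (1 + 2 * (η * μ)) *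
      (‖x - xstar‖ ^ 2 + η ^ 2 * ((1 / (M : ℝ)) * ∑ m, ‖d m‖ ^ 2))
        + (1 + η * μ) ^ 2 / (η * μ) ^ 2 * b := by
    calc _ ≤ (1 / (M : ℝ)) * ∑ m, (1 / (1 + 2 * (η * μ)) *
          (‖x - xstar‖ ^ 2 - 2 * η * ⟪x - xstar, d m⟫ + η ^ 2 * ‖d m‖ ^ 2)
            + (1 + η * μ) ^ 2 / (η * μ) ^ 2 * b) := by
          gcongr with m
          exact hy m
      _ = _ := by
          rw [Finset.sum_add_distrib, ← Finset.mul_sum, Finset.sum_add_distrib,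
            Finset.sum_sub_distrib, ← Finset.mul_sum, ← Finset.mul_sum, ← inner_sum, hdsum,
            inner_zero_right]
          simp only [Finset.sum_const, Finset.card_univ, Fintype.card_fin, nsmul_eq_mul]
          field_simp
          ring
  have hηδ : η ^ 2 * δ ^ 2 ≤ η * μ / 2 := by
    rw [div_le_iff₀ hμ] at hstep
    nlinarith
  have hαp : α * p = η * μ := by rw [hα]; field_simp
  have hα0 : 0 < α := by rw [hα]; positivity
  have hτ1 : τ ≤ η * μ / (1 + 2 * (η * μ)) := by
    rw [hτ, ← mul_assoc]
    exact min_le_left _ _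
  have hτ2 : τ ≤ p / 2 := hτ ▸ min_le_right _ _
  rw [hαp]
  set t := η * μ
  set X := ‖x - xstar‖ ^ 2
  set W := ‖w - xstar‖ ^ 2
  have hX : 0 ≤ X := by positivity
  have hW : 0 ≤ W := by positivity
  have hnoise : η ^ 2 * ((1 / (M : ℝ)) * ∑ m, ‖d m‖ ^ 2) ≤ t / 2 * W := by
    calc _ ≤ η ^ 2 * (δ ^ 2 * W) := by gcongr
      _ = η ^ 2 * δ ^ 2 * W := by ring
      _ ≤ _ := by gcongr
  have hratio : (1 + t) / (1 + 2 * t) = 1 - t / (1 + 2 * t) := by field_simp; ring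
  have hratio1 : (1 + t) / (1 + 2 * t) ≤ 1 := by
    rw [div_le_one (by positivity)]
    linarith
  have hmain : (1 + t) * ((1 / (M : ℝ)) * ∑ m, ‖x' m - xstar‖ ^ 2) ≤
      (1 + t) / (1 + 2 * t) * X + t / 2 * W + (1 + t) ^ 3 / t ^ 2 * b := by
    calc _ ≤ (1 + t) * (1 / (1 + 2 * t) * (X + t / 2 * W) + (1 + t) ^ 2 / t ^ 2 * b) := by
          gcongr
          refine havg.trans ?_
          gcongr
      _ = (1 + t) / (1 + 2 * t) * X + (1 + t) / (1 + 2 * t) * (t / 2 * W)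
            + (1 + t) ^ 3 / t ^ 2 * b := by ring
      _ ≤ _ := by
          have : (1 + t) / (1 + 2 * t) * (t / 2 * W) ≤ 1 * (t / 2 * W) := by gcongr
          linarith
  have hXle : (1 + t) / (1 + 2 * t) * X ≤ (1 - τ) * X := by
    gcongr
    linarith
  have hWle : t / 2 * W + α * (1 - p) * W ≤ (1 - τ) * (α * W) := by
    have : 0 ≤ (p / 2 - τ) * (α * W) := mul_nonneg (by linarith) (by positivity)
    rw [← hαp]
    linarith
  linarith
end
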